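/- Let p be an odd prime for which q = 2p-1 is a prime power. Then there exists a quaternary Legendre pair (a, b) of length 2p in which b is binary: i.e., sequences a with entries in {1,i,-1,-i} and b with entries in {±1}, both of length 2p, such that R_a(u) + R_b(u) = -2 for all u ≢ 0 mod 2p. -/

import Mathlib

/-- The periodic cross-correlation of two integer sequences. -/
def periodicCorr {G : Type*} [Fintype G] [Add G] (x y : G → ℤ) (t : G) : ℤ :=
  ∑ k, x k * y (k + t)

section Correlation

variable {G : Type*} [Fintype G] [AddCommGroup G]

theorem periodicCorr_add_left (x y z : G → ℤ) (t : G) :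
    periodicCorr (x + y) z t = periodicCorr x z t + periodicCorr y z t := by
  simp [periodicCorr, add_mul, Finset.sum_add_distrib]

theorem periodicCorr_add_right (x y z : G → ℤ) (t : G) :
    periodicCorr x (y + z) t = periodicCorr x y t + periodicCorr x z t := by
  simp [periodicCorr, mul_add, Finset.sum_add_distrib]

theorem periodicCorr_sub_left (x y z : G → ℤ) (t : G) :
    periodicCorr (x - y) z t = periodicCorr x z t - periodicCorr y z t := by
  simp [periodicCorr, sub_mul, Finset.sum_sub_distrib]

theorem periodicCorr_sub_right (x y z : G → ℤ) (t : G) :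
    periodicCorr x (y - z) t = periodicCorr x y t - periodicCorr x z t := by
  simp [periodicCorr, mul_sub, Finset.sum_sub_distrib]

theorem periodicCorr_neg_left (x y : G → ℤ) (t : G) :
    periodicCorr (-x) y t = -periodicCorr x y t := by
  simp [periodicCorr]

theorem periodicCorr_neg_right (x y : G → ℤ) (t : G) :
    periodicCorr x (-y) t = -periodicCorr x y t := by
  simp [periodicCorr]

theorem periodicCorr_comm_of_even {x y : G → ℤ} (hx : Function.Even x) (hy : Function.Even y)
    (t : G) : periodicCorr x y t = periodicCorr y x t := by
  unfold periodicCorr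
  refine Fintype.sum_equiv ((Equiv.neg G).trans (Equiv.subRight t)) _ _ fun k ↦ ?_
  have h₁ : -k - t = -(k + t) := by abel
  simp only [Equiv.trans_apply, Equiv.neg_apply, Equiv.subRight_apply, sub_add_cancel]
  rw [h₁, hx k, hy (k + t), mul_comm]

theorem periodicCorr_single_left [DecidableEq G] (x : G → ℤ) (t : G) :
    periodicCorr (Pi.single 0 1) x t = x t := by
  simp [periodicCorr, Pi.single_apply]

end Correlation

theorem even_single_zero {G : Type*} [AddGroup G] [DecidableEq G] :
    Function.Even (Pi.single 0 1 : G → ℤ) := fun k ↦ by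
  simp [Pi.single_apply]

section QuadraticCharacter

theorem periodicCorr_quadraticChar {F : Type*} [Field F] [Fintype F] [DecidableEq F]
    (hF : ringChar F ≠ 2) {t : F} (ht : t ≠ 0) :
    periodicCorr (quadraticChar F) (quadraticChar F) t = -1 := by
  have hJ := jacobiSum_nontrivial_inv (quadraticChar_ne_one hF)
  rw [(quadraticChar_isQuadratic F).inv, jacobiSum] at hJ
  have hsq : quadraticChar F (-1) * quadraticChar F (-1) = 1 := by
    rw [← map_mul]; simp
  have htt : quadraticChar F t * quadraticChar F t = 1 := by
    rw [← sq]; exact quadraticChar_sq_one ht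
  have key : periodicCorr (quadraticChar F) (quadraticChar F) t =
      ∑ x, quadraticChar F (-1) * (quadraticChar F x * quadraticChar F (1 - x)) := by
    unfold periodicCorr
    symm
    refine Fintype.sum_equiv (Equiv.mulLeft₀ (-t) (neg_ne_zero.mpr ht)) _ _ fun x ↦ ?_
    have h₁ : -t * x + t = t * (1 - x) := by ring
    have h₂ : -t * x = (-1) * t * x := by ring
    simp only [Equiv.mulLeft₀_apply, h₁]
    rw [h₂]
    simp only [map_mul]
    linear_combination (-quadraticChar F (-1) * quadraticChar F x * quadraticChar F (1 - x)) * htt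
  rw [key, ← Finset.mul_sum, hJ]
  linarith

theorem periodicCorr_quadraticChar_zero {F : Type*} [Field F] [Fintype F] [DecidableEq F] :
    periodicCorr (quadraticChar F) (quadraticChar F) 0 = Fintype.card F - 1 := by
  have h : ∀ k : F, quadraticChar F k * quadraticChar F (k + 0) = 1 - if k = 0 then 1 else 0 := by
    intro k
    by_cases hk : k = 0
    · simp [hk]
    · rw [add_zero, ← sq, quadraticChar_sq_one hk, if_neg hk, sub_zero]
  rw [periodicCorr, Finset.sum_congr rfl fun k _ ↦ h k]
  simp

end QuadraticCharacter

section GoethalsSeidel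

open QuadraticAlgebra

/-- A norm-one subgroup of odd prime order meets the base field only in `1`. -/
theorem addChar_eq_zero_of_im_eq_zero {F : Type*} [Field F] {p : ℕ} [Fact p.Prime]
    (hodd : Odd p) {ν : F}
    {φ : AddChar (ZMod p) (QuadraticAlgebra F ν 0)} (hφ : ∀ j, φ j = 1 → j = 0)
    (hnorm : ∀ j, norm (φ j) = 1) {j : ZMod p} (hj : (φ j).im = 0) : j = 0 := by
  have h₁ : φ j = algebraMap F _ (φ j).re := by
    ext <;> simp [hj]
  have h₂ : (φ j).re ^ 2 = 1 := by
    rw [← norm_algebraMap (a := ν) (b := 0), ← h₁, hnorm]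
  have h₃ : φ ((2 : ℕ) • j) = 1 := by
    rw [AddChar.map_nsmul_eq_pow, h₁, ← map_pow, h₂, map_one]
  have h₄ := hφ _ h₃
  have h₅ : ((2 : ℕ) : ZMod p) ≠ 0 := by
    rw [Ne, ZMod.natCast_eq_zero_iff]
    intro h
    have := (Nat.prime_dvd_prime_iff_eq Fact.out Nat.prime_two).mp h
    subst this
    exact absurd hodd (by decide)
  rw [nsmul_eq_mul] at h₄
  exact (mul_eq_zero.mp h₄).resolve_left h₅

variable {F : Type*} [Field F] [Fintype F] [DecidableEq F]

/-- Two values of an `F`-linear functional at `x` and at `x * z` are uncorrelated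
under the quadratic character when `z` is not in the base field. -/
theorem sum_quadraticChar_re_mul (hF : ringChar F ≠ 2) {ν : F} (hν : ν ≠ 0)
    [Fintype (QuadraticAlgebra F ν 0)] {z : QuadraticAlgebra F ν 0} (hz : z.im ≠ 0) :
    ∑ x : QuadraticAlgebra F ν 0, quadraticChar F x.re * quadraticChar F (x * z).re = 0 := by
  rw [Fintype.sum_equiv (equivProd ν 0) _
    (fun y ↦ quadraticChar F y.1 * quadraticChar F (y.1 * z.re + ν * y.2 * z.im))
    (fun x ↦ by simp [equivProd]), Fintype.sum_prod_type]
  refine Finset.sum_eq_zero fun r _ ↦ ?_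
  dsimp only
  rw [← Finset.mul_sum, Fintype.sum_equiv ((Equiv.mulLeft₀ (ν * z.im) (mul_ne_zero hν hz)).trans
    (Equiv.addLeft (r * z.re))) _ (quadraticChar F) (fun s ↦ ?_), quadraticChar_sum_zero hF,
    mul_zero]
  congr 1
  simp only [Equiv.trans_apply, Equiv.mulLeft₀_apply, Equiv.coe_addLeft]
  ring

/-- The quadratic extension `F(√ν)` contains a group of order `p` of norm-one elements. -/
theorem exists_addChar_norm_eq_one {p : ℕ} [Fact p.Prime] (hodd : Odd p)
    (hcard : Fintype.card F = 2 * p - 1) {ν : F} [Fact (∀ r, r ^ 2 ≠ ν + 0 * r)] :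
    ∃ φ : AddChar (ZMod p) (QuadraticAlgebra F ν 0),
      (∀ j, φ j = 1 → j = 0) ∧ ∀ j, norm (φ j) = 1 := by
  classical
  have hp : p.Prime := Fact.out
  let := Fintype.ofEquiv _ (equivProd ν (0 : F)).symm
  have hK : Fintype.card (QuadraticAlgebra F ν 0) = (2 * p - 1) * (2 * p - 1) := by
    rw [Fintype.card_congr (equivProd ν (0 : F)), Fintype.card_prod, hcard]
  have hdvd : p ∣ Fintype.card (QuadraticAlgebra F ν 0)ˣ := by
    rw [Fintype.card_units, hK]
    obtain ⟨m, rfl⟩ : ∃ m, p = m + 1 := ⟨p - 1, by have := hp.pos; omega⟩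
    refine ⟨4 * m, ?_⟩
    have h₁ : 2 * (m + 1) - 1 = 2 * m + 1 := by omega
    rw [h₁, Nat.sub_eq_iff_eq_add (by nlinarith)]
    ring
  obtain ⟨g, hg⟩ := exists_prime_orderOf_dvd_card p hdvd
  have hgp : (g : QuadraticAlgebra F ν 0) ^ p = 1 := by
    rw [← Units.val_pow_eq_pow_val, ← hg, pow_orderOf_eq_one, Units.val_one]
  refine ⟨AddChar.zmodChar p hgp, fun j hj ↦ ?_, fun j ↦ ?_⟩
  · rw [AddChar.zmodChar_apply, ← Units.val_pow_eq_pow_val, Units.val_eq_one,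
      ← orderOf_dvd_iff_pow_eq_one, hg] at hj
    rw [← ZMod.natCast_zmod_val j]
    exact (ZMod.natCast_eq_zero_iff _ _).mpr hj
  · rw [AddChar.zmodChar_apply, map_pow]
    suffices h : norm (g : QuadraticAlgebra F ν 0) = 1 by rw [h, one_pow]
    have h₁ : norm (g : QuadraticAlgebra F ν 0) ^ p = 1 := by rw [← map_pow, hgp, map_one]
    have h₂ : norm (g : QuadraticAlgebra F ν 0) ^ (2 * p - 2) = 1 := by
      have := FiniteField.pow_card_sub_one_eq_one (norm (g : QuadraticAlgebra F ν 0))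
        (norm_eq_zero_iff_eq_zero.not.mpr g.ne_zero)
      rwa [hcard] at this
    have hcop : Nat.gcd p (2 * p - 2) = 1 := by
      rw [← Nat.coprime_iff_gcd_eq_one, hp.coprime_iff_not_dvd]
      intro h
      have h₃ : p ∣ 2 :=
        (Nat.dvd_sub_iff_right (by have := hp.two_le; omega) (dvd_mul_left p 2)).mp h
      have := (Nat.prime_dvd_prime_iff_eq hp Nat.prime_two).mp h₃
      subst this
      exact absurd hodd (by decide)
    rw [← orderOf_dvd_iff_pow_eq_one] at h₁ h₂
    rw [← orderOf_eq_one_iff]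
    exact Nat.dvd_one.mp (hcop ▸ Nat.dvd_gcd h₁ h₂)

/-- Complementary symmetric ternary sequences from a finite field with `2 * p - 1` elements. -/
theorem exists_symmetric_ternary_pair_of_card {p : ℕ} [Fact p.Prime] (hodd : Odd p)
    (hcard : Fintype.card F = 2 * p - 1) :
    ∃ c d : ZMod p → ℤ, Function.Even c ∧ Function.Even d ∧ c 0 = 0 ∧
      (∀ j, j ≠ 0 → c j = 1 ∨ c j = -1) ∧ (∀ j, d j = 1 ∨ d j = -1) ∧
      ∀ u, u ≠ 0 → periodicCorr c c u + periodicCorr d d u = 0 := by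
  classical
  have hp : p.Prime := Fact.out
  have hp2 : 2 ≤ p := hp.two_le
  have hmod : Fintype.card F % 4 = 1 := by
    obtain ⟨m, rfl⟩ := hodd
    omega
  have hF : ringChar F ≠ 2 := fun h ↦ by
    have := FiniteField.even_card_of_char_two h
    omega
  obtain ⟨s, hs⟩ : IsSquare (-1 : F) := FiniteField.isSquare_neg_one_iff.mpr (by omega)
  obtain ⟨ν, hνsq⟩ := FiniteField.exists_nonsquare hF
  have hν : ν ≠ 0 := fun h ↦ hνsq (h ▸ IsSquare.zero)
  have hνneg : ∀ r y : F, y ≠ 0 → r ^ 2 ≠ -(ν * y ^ 2) := fun r y hy h ↦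
    hνsq ⟨s * r / y, by field_simp; linear_combination r ^ 2 * hs + h⟩
  have : Fact (∀ r, r ^ 2 ≠ ν + 0 * r) := ⟨fun r hr ↦ hνsq ⟨r, by linear_combination -hr⟩⟩
  obtain ⟨φ, hφ, hnorm⟩ := exists_addChar_norm_eq_one (ν := ν) hodd hcard
  have him : ∀ {j}, (φ j).im = 0 → j = 0 := addChar_eq_zero_of_im_eq_zero hodd hφ hnorm
  have hre : ∀ j, (φ j).re ≠ 0 := fun j hj ↦ by
    have h := hnorm j
    rw [norm_def, hj] at h
    refine hνneg 1 (φ j).im (fun h₀ ↦ ?_) (by linear_combination -h)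
    simp [h₀] at h
  have hneg : ∀ j, φ (-j) = star (φ j) := fun j ↦ by
    have h₁ : φ j * φ (-j) = 1 := by rw [← AddChar.map_add_eq_mul]; simp
    have h₂ : φ j * star (φ j) = 1 := by
      rw [← algebraMap_norm_eq_mul_star, hnorm, map_one]
    exact mul_left_cancel₀ (left_ne_zero_of_mul_eq_one h₁) (h₁.trans h₂.symm)
  have hχneg : ∀ x : F, quadraticChar F (-x) = quadraticChar F x := fun x ↦ by
    have : quadraticChar F (-1) = 1 :=
      (quadraticChar_one_iff_isSquare (neg_ne_zero.mpr one_ne_zero)).mpr ⟨s, hs⟩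
    rw [neg_eq_neg_one_mul, map_mul, this, one_mul]
  refine ⟨fun j ↦ quadraticChar F (φ j).im, fun j ↦ quadraticChar F (φ j).re, fun j ↦ ?_,
    fun j ↦ ?_, ?_, fun j hj ↦ quadraticChar_dichotomy fun h ↦ hj (him h),
    fun j ↦ quadraticChar_dichotomy (hre j), fun u hu ↦ ?_⟩
  · simp only [hneg, im_star, hχneg]
  · simp only [hneg, re_star, zero_mul, add_zero]
  · simp only [AddChar.map_zero_eq_one, im_one, MulChar.map_zero]
  let := Fintype.ofEquiv _ (equivProd ν (0 : F)).symm
  let e : Fˣ × Bool × ZMod p → QuadraticAlgebra F ν 0 := fun i ↦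
    (i.1 : F) • ((if i.2.1 then ω else 1) * φ i.2.2)
  have hω : norm (ω : QuadraticAlgebra F ν 0) = -ν := by simp [norm_def]
  have hω₀ : (ω : QuadraticAlgebra F ν 0) ≠ 0 := fun h ↦ by
    simp [h, hν] at hω
  have henorm : ∀ i, norm (e i) = (i.1 : F) ^ 2 * if i.2.1 then -ν else 1 := fun i ↦ by
    simp only [e, Algebra.smul_def, map_mul, QuadraticAlgebra.norm_algebraMap, hnorm, mul_one]
    split_ifs <;> simp [hω]
  have hinj : Function.Injective e := by
    rintro ⟨x, b, j⟩ ⟨y, b', k⟩ h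
    have hn := congrArg QuadraticAlgebra.norm h
    rw [henorm, henorm] at hn
    obtain rfl : b = b' := by
      cases b <;> cases b'
      · rfl
      · exact absurd (by simpa [mul_comm ν] using hn) (hνneg x y y.ne_zero)
      · exact absurd (by simpa [mul_comm ν] using hn.symm) (hνneg y x x.ne_zero)
      · rfl
    have h₁ : (x : F) • φ j = (y : F) • φ k := by
      have hb : (if b then ω else 1 : QuadraticAlgebra F ν 0) ≠ 0 := by
        split_ifs
        exacts [hω₀, one_ne_zero]
      simp only [e, ← mul_smul_comm] at h
      exact mul_left_cancel₀ hb h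
    have h₂ : (x : F) • φ (j - k) = (y : F) • 1 := by
      rw [sub_eq_add_neg, AddChar.map_add_eq_mul, ← smul_mul_assoc, h₁, smul_mul_assoc,
        ← AddChar.map_add_eq_mul, add_neg_cancel, AddChar.map_zero_eq_one]
    have h₃ : j - k = 0 := him (by
      have := congrArg QuadraticAlgebra.im h₂
      simpa using this)
    obtain rfl := sub_eq_zero.mp h₃
    have h₄ := congrArg QuadraticAlgebra.re h₂
    simp only [sub_self, AddChar.map_zero_eq_one, re_smul, re_one, smul_eq_mul, mul_one] at h₄
    rw [Units.ext h₄]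
  have he₀ : ∀ i, e i ≠ 0 := fun i h ↦ by
    have h₁ := henorm i
    rw [h, QuadraticAlgebra.norm_zero] at h₁
    refine mul_ne_zero (pow_ne_zero 2 i.1.ne_zero) ?_ h₁.symm
    split_ifs
    exacts [neg_ne_zero.mpr hν, one_ne_zero]
  have hsurj : ∀ x ∉ Set.range e, x = 0 := by
    have himage : Finset.univ.image e = Finset.univ.erase 0 := by
      refine Finset.eq_of_subset_of_card_le (fun x hx ↦ ?_) ?_
      · obtain ⟨i, -, rfl⟩ := Finset.mem_image.mp hx
        exact Finset.mem_erase.mpr ⟨he₀ i, Finset.mem_univ _⟩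
      · rw [Finset.card_image_of_injective _ hinj, Finset.card_erase_of_mem (Finset.mem_univ _),
          Finset.card_univ, Finset.card_univ, Fintype.card_congr (equivProd ν (0 : F))]
        simp only [Fintype.card_prod, Fintype.card_units, Fintype.card_bool, ZMod.card, hcard]
        obtain ⟨m, rfl⟩ : ∃ m, p = m + 1 := ⟨p - 1, by omega⟩
        have h₁ : 2 * (m + 1) - 1 = 2 * m + 1 := by omega
        rw [h₁, Nat.add_sub_cancel, Nat.sub_le_iff_le_add]
        nlinarith
    intro x hx
    by_contra h
    refine hx ?_
    have : x ∈ Finset.univ.image e := himage ▸ Finset.mem_erase.mpr ⟨h, Finset.mem_univ _⟩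
    simpa using this
  have hsum := sum_quadraticChar_re_mul hF hν (z := φ u) (fun h ↦ hu (him h))
  rw [← Fintype.sum_of_injective e hinj
    (fun i ↦ if i.2.1 then quadraticChar F (φ i.2.2).im * quadraticChar F (φ (i.2.2 + u)).im
      else quadraticChar F (φ i.2.2).re * quadraticChar F (φ (i.2.2 + u)).re) _
    (fun x hx ↦ by simp [hsurj x hx]) ?_] at hsum
  · simp only [Fintype.sum_prod_type, Finset.sum_const, Fintype.sum_bool, Finset.card_univ,
      nsmul_eq_mul] at hsum
    have hunits : (Fintype.card Fˣ : ℤ) ≠ 0 := by exact_mod_cast Fintype.card_ne_zero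
    simpa [periodicCorr] using (mul_eq_zero.mp hsum).resolve_left hunits
  · rintro ⟨x, b, j⟩
    have hx : quadraticChar F x * quadraticChar F x = 1 := by
      rw [← sq]; exact quadraticChar_sq_one x.ne_zero
    have hνχ : quadraticChar F ν * quadraticChar F ν = 1 := by
      rw [← sq]; exact quadraticChar_sq_one hν
    have h₁ : e (x, b, j) * φ u = e (x, b, j + u) := by
      simp only [e, AddChar.map_add_eq_mul, smul_mul_assoc, mul_assoc]
    rw [h₁]
    cases b
    · have h₂ : ∀ k, (e (x, false, k)).re = x * (φ k).re := fun k ↦ by simp [e]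
      simp only [h₂, map_mul, Bool.false_eq_true, if_false]
      linear_combination (-quadraticChar F (φ j).re * quadraticChar F (φ (j + u)).re) * hx
    · have h₂ : ∀ k, (e (x, true, k)).re = x * (ν * (φ k).im) := fun k ↦ by simp [e]
      simp only [h₂, map_mul, if_true]
      linear_combination (-quadraticChar F (φ j).im * quadraticChar F (φ (j + u)).im) *
        (hx * quadraticChar F ν ^ 2 + hνχ)

end GoethalsSeidel

/-- Goethals and Seidel: complementary symmetric ternary sequences with a single zero. -/
theorem exists_symmetric_ternary_pair {p : ℕ} [Fact p.Prime] (hodd : Odd p)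
    (hq : IsPrimePow (2 * p - 1)) :
    ∃ c d : ZMod p → ℤ, Function.Even c ∧ Function.Even d ∧ c 0 = 0 ∧
      (∀ j, j ≠ 0 → c j = 1 ∨ c j = -1) ∧ (∀ j, d j = 1 ∨ d j = -1) ∧
      ∀ u, u ≠ 0 → periodicCorr c c u + periodicCorr d d u = 0 := by
  classical
  obtain ⟨l, k, hl, hk, h⟩ := hq
  have : Fact l.Prime := ⟨hl.nat_prime⟩
  have : Fintype (GaloisField l k) := Fintype.ofFinite _
  refine exists_symmetric_ternary_pair_of_card (F := GaloisField l k) hodd ?_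
  rw [← h, ← GaloisField.card l k hk.ne', Nat.card_eq_fintype_card]

section Quaternary

open Complex

/-- The sequence `((1 + i) x + (1 - i) y) / 2`, which is quaternary if `x` and `y` are binary. -/
noncomputable def quaternaryOfBinary {G : Type*} (x y : G → ℤ) (k : G) : ℂ :=
  ((1 + I) * x k + (1 - I) * y k) / 2

theorem quaternaryOfBinary_mem {G : Type*} {x y : G → ℤ} {k : G} (hx : x k = 1 ∨ x k = -1)
    (hy : y k = 1 ∨ y k = -1) : quaternaryOfBinary x y k ∈ ({1, I, -1, -I} : Set ℂ) := by
  simp only [quaternaryOfBinary, Set.mem_insert_iff, Set.mem_singleton_iff]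
  rcases hx with hx | hx <;> rcases hy with hy | hy <;> rw [hx, hy]
  · left; push_cast; ring
  · right; left; push_cast; ring
  · right; right; right; push_cast; ring
  · right; right; left; push_cast; ring

theorem sum_quaternaryOfBinary_mul_conj {G : Type*} [Fintype G] [AddCommGroup G]
    (x y z w : G → ℤ) (t : G) :
    ∑ k, quaternaryOfBinary x y k * (starRingEnd ℂ) (quaternaryOfBinary z w (k + t)) =
      ((periodicCorr x z t + periodicCorr y w t : ℤ) +
        I * (periodicCorr x w t - periodicCorr y z t : ℤ)) / 2 := by
  simp only [periodicCorr, ← Finset.sum_add_distrib, ← Finset.sum_sub_distrib, Int.cast_sum,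
    Finset.mul_sum, Finset.sum_div]
  refine Finset.sum_congr rfl fun k _ ↦ ?_
  simp only [quaternaryOfBinary, map_div₀, map_add, map_mul, map_sub, map_one, conj_I, map_intCast,
    map_ofNat]
  push_cast
  linear_combination (-(x k * z (k + t) : ℂ) - y k * w (k + t) + x k * w (k + t)
    + y k * z (k + t)) / 4 * I_sq

theorem sum_intCast_mul_conj {G : Type*} [Fintype G] [AddCommGroup G] (x y : G → ℤ) (t : G) :
    ∑ k, (x k : ℂ) * (starRingEnd ℂ) (y (k + t) : ℂ) = (periodicCorr x y t : ℤ) := by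
  simp [periodicCorr]

/-- Interleave two sequences on `ZMod p` along `ZMod (2 * p) ≃+* ZMod 2 × ZMod p`. -/
noncomputable def interleave {p : ℕ} (h : Nat.Coprime 2 p) (s₀ s₁ : ZMod p → ℂ)
    (k : ZMod (2 * p)) : ℂ :=
  if (ZMod.chineseRemainder h k).1 = 0 then s₀ (ZMod.chineseRemainder h k).2
  else s₁ (ZMod.chineseRemainder h k).2

theorem sum_interleave_mul_conj {p : ℕ} [NeZero p] [NeZero (2 * p)] (h : Nat.Coprime 2 p)
    (s₀ s₁ : ZMod p → ℂ) (u : ZMod (2 * p)) :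
    ∑ k, interleave h s₀ s₁ k * (starRingEnd ℂ) (interleave h s₀ s₁ (k + u)) =
      if (ZMod.chineseRemainder h u).1 = 0 then
        ∑ k, s₀ k * (starRingEnd ℂ) (s₀ (k + (ZMod.chineseRemainder h u).2)) +
          ∑ k, s₁ k * (starRingEnd ℂ) (s₁ (k + (ZMod.chineseRemainder h u).2))
      else
        ∑ k, s₀ k * (starRingEnd ℂ) (s₁ (k + (ZMod.chineseRemainder h u).2)) +
          ∑ k, s₁ k * (starRingEnd ℂ) (s₀ (k + (ZMod.chineseRemainder h u).2)) := by
  rw [Fintype.sum_equiv (ZMod.chineseRemainder h).toEquiv _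
    (fun k : ZMod 2 × ZMod p ↦ (if k.1 = 0 then s₀ k.2 else s₁ k.2) * (starRingEnd ℂ)
      (if (k + ZMod.chineseRemainder h u).1 = 0 then s₀ (k + ZMod.chineseRemainder h u).2
        else s₁ (k + ZMod.chineseRemainder h u).2))
    (fun k ↦ by simp [interleave, map_add])]
  generalize ZMod.chineseRemainder h u = v
  obtain ⟨ε, t⟩ := v
  have huniv : ∀ f : ZMod 2 → ℂ, ∑ i, f i = f 0 + f 1 := Fin.sum_univ_two
  rw [Fintype.sum_prod_type, huniv]
  obtain rfl | rfl : ε = 0 ∨ ε = 1 := by revert ε; decide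
  · simp
  · have h₁ : (1 + 1 : ZMod 2) = 0 := by decide
    simp [h₁]

end Quaternary

open Finset Complex in
/-- Theorem 2: if `p` is an odd prime with `2p - 1` a prime power, then there is a
quaternary Legendre pair `(a, b)` of length `2p` in which `b` is binary. -/
theorem exists_quaternary_legendre_pair (p : ℕ) [Fact p.Prime] (hodd : Odd p)
    (hq : IsPrimePow (2 * p - 1)) [NeZero (2 * p)] :
    ∃ a b : ZMod (2 * p) → ℂ,
      (∀ k, a k ∈ ({1, I, -1, -I} : Set ℂ)) ∧
      (∀ k, b k = 1 ∨ b k = -1) ∧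
      ∀ u : ZMod (2 * p), u ≠ 0 →
        (∑ k : ZMod (2 * p), a k * (starRingEnd ℂ) (a (k + u))) +
          ∑ k : ZMod (2 * p), b k * (starRingEnd ℂ) (b (k + u)) = -2 := by
  have hp : p.Prime := Fact.out
  have hcop : Nat.Coprime 2 p := (Nat.coprime_two_left).mpr hodd
  obtain ⟨c, d, hc, hd, hc₀, hc₁, hd₁, hcd⟩ := exists_symmetric_ternary_pair hodd hq
  let χ : ZMod p → ℤ := quadraticChar (ZMod p)
  let δ : ZMod p → ℤ := Pi.single 0 1
  have hF : ringChar (ZMod p) ≠ 2 := by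
    rw [ZMod.ringChar_zmod_n]
    rintro rfl
    exact absurd hodd (by decide)
  have hweight : periodicCorr c c 0 + periodicCorr d d 0 = 2 * p - 1 := by
    have h₁ : ∀ k, c k * c (k + 0) = 1 - if k = 0 then 1 else 0 := fun k ↦ by
      by_cases hk : k = 0
      · simp [hk, hc₀]
      · rcases hc₁ k hk with h | h <;> simp [hk, h]
    have h₂ : ∀ k, d k * d (k + 0) = 1 := fun k ↦ by
      rcases hd₁ k with h | h <;> simp [h]
    simp only [periodicCorr, h₁, h₂]
    simp
    ring
  have hplus : ∀ x : ZMod p → ℤ, x 0 = 0 → (∀ k, k ≠ 0 → x k = 1 ∨ x k = -1) →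
      ∀ k, (x + δ) k = 1 ∨ (x + δ) k = -1 := fun x h₀ h₁ k ↦ by
    by_cases hk : k = 0
    · simp [δ, hk, h₀]
    · simpa [δ, hk] using h₁ k hk
  have hminus : ∀ x : ZMod p → ℤ, x 0 = 0 → (∀ k, k ≠ 0 → x k = 1 ∨ x k = -1) →
      ∀ k, (x - δ) k = 1 ∨ (x - δ) k = -1 := fun x h₀ h₁ k ↦ by
    by_cases hk : k = 0
    · simp [δ, hk, h₀]
    · simpa [δ, hk] using h₁ k hk
  have hχ₀ : χ 0 = 0 := by simp [χ]
  have hχ₁ : ∀ k, k ≠ 0 → χ k = 1 ∨ χ k = -1 := fun k hk ↦ quadraticChar_dichotomy hk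
  have hδc : ∀ t, periodicCorr δ c t = c t := periodicCorr_single_left c
  have hδd : ∀ t, periodicCorr δ d t = d t := periodicCorr_single_left d
  have hδδ : ∀ t, periodicCorr δ δ t = δ t := periodicCorr_single_left δ
  have hcδ : ∀ t, periodicCorr c δ t = c t := fun t ↦ by
    rw [periodicCorr_comm_of_even hc even_single_zero, hδc]
  have hdδ : ∀ t, periodicCorr d δ t = d t := fun t ↦ by
    rw [periodicCorr_comm_of_even hd even_single_zero, hδd]
  have hdc : ∀ t, periodicCorr d c t = periodicCorr c d t := periodicCorr_comm_of_even hd hc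
  have hcdδ : ∀ t, periodicCorr c c t + periodicCorr d d t = (2 * p - 1) * δ t := fun t ↦ by
    by_cases ht : t = 0
    · simp [ht, hweight, δ]
    · simp [hcd t ht, δ, ht]
  have hχχ : ∀ t, periodicCorr χ χ t = p * δ t - 1 := fun t ↦ by
    by_cases ht : t = 0
    · simp [χ, ht, periodicCorr_quadraticChar_zero, δ]
    · simp [χ, periodicCorr_quadraticChar hF ht, δ, ht]
  let a₀ := quaternaryOfBinary (c + δ) d
  let a₁ := quaternaryOfBinary (-(c - δ)) (-d)
  let b₀ : ZMod p → ℂ := fun k ↦ ((χ + δ) k : ℤ)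
  let b₁ : ZMod p → ℂ := fun k ↦ ((χ - δ) k : ℤ)
  have hcast : ∀ x : ℤ, x = 1 ∨ x = -1 → (x : ℂ) = 1 ∨ (x : ℂ) = -1 := fun x hx ↦
    hx.imp (fun h ↦ by simp [h]) fun h ↦ by simp [h]
  have hneg : ∀ x : ℤ, x = 1 ∨ x = -1 → -x = 1 ∨ -x = -1 := by omega
  refine ⟨interleave hcop a₀ a₁, interleave hcop b₀ b₁, fun k ↦ ?_, fun k ↦ ?_, fun u hu ↦ ?_⟩
  · unfold interleave
    split_ifs
    · exact quaternaryOfBinary_mem (hplus c hc₀ hc₁ _) (hd₁ _)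
    · exact quaternaryOfBinary_mem (hneg _ (hminus c hc₀ hc₁ _)) (hneg _ (hd₁ _))
  · unfold interleave
    split_ifs
    · exact hcast _ (hplus χ hχ₀ hχ₁ _)
    · exact hcast _ (hminus χ hχ₀ hχ₁ _)
  · have hv : ZMod.chineseRemainder hcop u ≠ 0 := by simpa using hu
    rw [sum_interleave_mul_conj, sum_interleave_mul_conj]
    generalize ZMod.chineseRemainder hcop u = v at hv ⊢
    obtain ⟨ε, t⟩ := v
    have h₁ : (periodicCorr c c t : ℂ) + periodicCorr d d t = (2 * p - 1) * δ t := by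
      exact_mod_cast hcdδ t
    simp only [a₀, a₁, b₀, b₁, sum_quaternaryOfBinary_mul_conj, sum_intCast_mul_conj,
      periodicCorr_add_left, periodicCorr_add_right, periodicCorr_sub_left, periodicCorr_sub_right,
      periodicCorr_neg_left, periodicCorr_neg_right, hδc, hδd, hδδ, hcδ, hdδ, hdc, hχχ]
    split_ifs with hε
    · have ht : t ≠ 0 := by
        rintro rfl
        exact hv (Prod.ext hε rfl)
      have hδt : (δ t : ℂ) = 0 := by simp [δ, ht]
      push_cast
      linear_combination h₁ + (4 * p + 2) * hδt
    · push_cast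
      linear_combination -h₁
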